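/- Let H be a separable real Hilbert space, let (P_n) be a sequence of Borel probability measures on H converging weakly to a Borel probability measure P, and assume P satisfies H1. Assume moreover that the function x ↦ ‖∫_H g_x dP‖ has a unique minimizer x* ∈ H. Then any sequence (x_n) of maximizers, x_n ∈ argmax_x D(x, P_n), converges in norm to x* = argmax_x D(x, P) as n → ∞. -/

import Mathlib

open MeasureTheory Filter Topology

/-- The direction function `g_x(z) = (z - x)/‖z - x‖` (with `g_x(x) = 0`). -/
noncomputable def gdir {H : Type*} [NormedAddCommGroup H] [InnerProductSpace ℝ H]
    (x z : H) : H := ‖z - x‖⁻¹ • (z - x)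

/-- The depth of `x` with respect to a measure `Q`: `D(x, Q) = 1 - ‖∫ g_x dQ‖`. -/
noncomputable def depth {H : Type*} [NormedAddCommGroup H] [InnerProductSpace ℝ H]
    [MeasurableSpace H] (x : H) (Q : Measure H) : ℝ :=
  1 - ‖∫ z, gdir x z ∂Q‖

/-- A one-sided quantitative comparison of integrals of Lipschitz functions in terms of the
Lévy–Prokhorov distance. -/
theorem integral_le_integral_add_of_levyProkhorovEDist_lt {X : Type*} [PseudoMetricSpace X]
    [MeasurableSpace X] [OpensMeasurableSpace X] (μ ν : Measure X) [IsProbabilityMeasure μ]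
    [IsProbabilityMeasure ν] {ε L : ℝ} (hε : 0 < ε) (hL : 0 ≤ L)
    (h : levyProkhorovEDist μ ν < ENNReal.ofReal ε) {f : X → ℝ}
    (hf : ∀ x y, |f x - f y| ≤ L * dist x y) (hf1 : ∀ x, |f x| ≤ 1) :
    ∫ x, f x ∂μ ≤ ∫ x, f x ∂ν + (L * ε + (2 + L * ε) * ε) := by
  have hcont : Continuous f :=
    (LipschitzWith.of_dist_le_mul (K := ⟨L, hL⟩) hf).continuous
  have hint (m : Measure X) [IsProbabilityMeasure m] (c : ℝ) :
      Integrable (fun x => f x + c) m :=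
    (Integrable.of_bound hcont.measurable.aestronglyMeasurable 1
      (Eventually.of_forall hf1)).add (integrable_const c)
  have hLε : 0 ≤ L * ε := by positivity
  have hmeas (m : Measure X) [IsProbabilityMeasure m] (c : ℝ) :
      IntegrableOn (fun t : ℝ => m.real {x | t ≤ f x + c}) (Set.Ioc 0 (2 + L * ε)) := by
    apply Measure.integrableOn_of_bounded (M := 1) measure_Ioc_lt_top.ne
    · apply (Measurable.ennreal_toReal (Antitone.measurable ?_)).aestronglyMeasurable
      exact fun _ _ hst ↦ measure_mono (fun _ h ↦ hst.trans h)
    · refine Eventually.of_forall fun t ↦ ?_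
      rw [Real.norm_eq_abs, abs_of_nonneg measureReal_nonneg]
      exact measureReal_le_one
  have hcake (m : Measure X) [IsProbabilityMeasure m] (c : ℝ) (hc : 1 ≤ c)
      (hc' : c ≤ 1 + L * ε) :
      ∫ x, f x ∂m + c = ∫ t in Set.Ioc 0 (2 + L * ε), m.real {x | t ≤ f x + c} := by
    rw [← (hint m c).integral_eq_integral_Ioc_meas_le]
    · rw [integral_add (by simpa using hint m 0) (integrable_const c)]
      simp
    · exact Eventually.of_forall fun x => by
        have := abs_le.1 (hf1 x); simp only [Pi.zero_apply]; linarith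
    · exact Eventually.of_forall fun x => by
        have := abs_le.1 (hf1 x); simp only; linarith
  have key (t : ℝ) : μ.real {x | t ≤ f x + 1} ≤ ν.real {x | t ≤ f x + (1 + L * ε)} + ε := by
    have h1 := left_measure_le_of_levyProkhorovEDist_lt h (B := {x | t ≤ f x + 1})
      ((hcont.add continuous_const).measurable measurableSet_Ici)
    rw [ENNReal.toReal_ofReal hε.le] at h1
    have h2 : Metric.thickening ε {x | t ≤ f x + 1} ⊆ {x | t ≤ f x + (1 + L * ε)} := by
      intro x hx
      obtain ⟨y, hy, hxy⟩ := Metric.mem_thickening_iff.1 hx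
      have h3 := (abs_le.1 (hf x y)).1
      have h4 : L * dist x y ≤ L * ε := by gcongr
      simp only [Set.mem_ofPred_eq] at hy ⊢
      linarith
    have h5 := ENNReal.toReal_mono (by finiteness)
      (h1.trans (add_le_add_left (measure_mono h2) _))
    rwa [ENNReal.toReal_add (by finiteness) (by finiteness), ENNReal.toReal_ofReal hε.le] at h5
  have h6 := setIntegral_mono (s := Set.Ioc 0 (2 + L * ε)) (hmeas μ 1)
    ((hmeas ν (1 + L * ε)).add (integrable_const ε)) key
  simp only [Pi.add_apply] at h6
  rw [integral_add (hmeas ν (1 + L * ε)) (integrable_const ε), ← hcake μ 1 le_rfl (by linarith),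
    ← hcake ν (1 + L * ε) (by linarith) le_rfl] at h6
  have h7 : ∫ _ in Set.Ioc 0 (2 + L * ε), ε = (2 + L * ε) * ε := by
    simp [max_eq_left (show (0:ℝ) ≤ 2 + L * ε by linarith)]
  linarith

/-- Weak convergence of probability measures is uniform over functions bounded by one with a common
Lipschitz constant. -/
theorem eventually_forall_abs_integral_sub_le {X : Type*} [PseudoMetricSpace X]
    [SecondCountableTopology X] [MeasurableSpace X] [BorelSpace X]
    {Pn : ℕ → ProbabilityMeasure X} {P : ProbabilityMeasure X}
    (hweak : Tendsto Pn atTop (𝓝 P)) {L : ℝ} (hL : 0 ≤ L) {ε : ℝ} (hε : 0 < ε) :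
    ∀ᶠ n in atTop, ∀ f : X → ℝ, (∀ x y, |f x - f y| ≤ L * dist x y) → (∀ x, |f x| ≤ 1) →
      |∫ x, f x ∂(Pn n : Measure X) - ∫ x, f x ∂(P : Measure X)| ≤ ε := by
  obtain ⟨η, hη, hηε⟩ : ∃ η : ℝ, 0 < η ∧ L * η + (2 + L * η) * η ≤ ε := by
    have hc : Tendsto (fun η : ℝ => L * η + (2 + L * η) * η) (𝓝[>] 0) (𝓝 0) := by
      have : Continuous (fun η : ℝ => L * η + (2 + L * η) * η) := by fun_prop
      simpa using (this.tendsto 0).mono_left nhdsWithin_le_nhds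
    obtain ⟨η, h1, h2⟩ := ((hc.eventually (Iio_mem_nhds hε)).and self_mem_nhdsWithin).exists
    exact ⟨η, h2, le_of_lt h1⟩
  have hLP := (LevyProkhorov.continuous_ofMeasure_probabilityMeasure.tendsto P).comp hweak
  filter_upwards [Metric.tendsto_nhds.1 hLP η hη] with n hn f hf hf1
  rw [Function.comp_apply, LevyProkhorov.dist_probabilityMeasure_def, levyProkhorovDist] at hn
  have h1 : levyProkhorovEDist (Pn n : Measure X) (P : Measure X) < ENNReal.ofReal η :=
    (ENNReal.lt_ofReal_iff_toReal_lt (levyProkhorovEDist_ne_top _ _)).2 hn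
  have h2 := integral_le_integral_add_of_levyProkhorovEDist_lt _ _ hη hL h1 hf hf1
  rw [levyProkhorovEDist_comm] at h1
  have h3 := integral_le_integral_add_of_levyProkhorovEDist_lt _ _ hη hL h1 hf hf1
  rw [abs_le]
  constructor <;> linarith

/-- A finite measure without atoms gives uniformly small mass to small balls. -/
theorem exists_forall_measureReal_ball_le {X : Type*} [MetricSpace X] [CompleteSpace X]
    [SecondCountableTopology X] [MeasurableSpace X] [BorelSpace X] (μ : Measure X)
    [IsFiniteMeasure μ] (hμ : ∀ x, μ {x} = 0) {ε : ℝ} (hε : 0 < ε) :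
    ∃ η > 0, ∀ x, μ.real (Metric.ball x η) ≤ ε := by
  have hε' : 0 < ENNReal.ofReal ε := ENNReal.ofReal_pos.2 hε
  obtain ⟨K, hK, hKμ⟩ := isTightMeasureSet_iff_exists_isCompact_measure_compl_le.1
    (isTightMeasureSet_singleton (μ := μ)) _ hε'
  have hball (y : X) : ∃ r > 0, μ (Metric.ball y r) ≤ ENNReal.ofReal ε := by
    have h1 : Tendsto (fun r => μ (Metric.closedBall y r)) (𝓝[>] 0)
        (𝓝 (μ (⋂ r > (0 : ℝ), Metric.closedBall y r))) :=
      tendsto_measure_biInter_gt (fun r _ => Metric.isClosed_closedBall.nullMeasurableSet)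
        (fun _ _ _ h => Metric.closedBall_subset_closedBall h) ⟨1, one_pos, by finiteness⟩
    have h2 : (⋂ r > (0 : ℝ), Metric.closedBall y r) = {y} := by
      ext z
      simp only [Set.mem_iInter, Metric.mem_closedBall, Set.mem_singleton_iff]
      refine ⟨fun h => dist_le_zero.1 (le_of_forall_gt_imp_ge_of_dense h), ?_⟩
      rintro rfl r hr
      simpa using hr.le
    rw [h2, hμ y] at h1
    obtain ⟨r, h3, h4⟩ := ((h1.eventually (Iio_mem_nhds hε')).and self_mem_nhdsWithin).exists
    exact ⟨r, h4, (measure_mono Metric.ball_subset_closedBall).trans (le_of_lt h3)⟩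
  choose r hr hrμ using hball
  obtain ⟨δ, hδ, hδK⟩ := lebesgue_number_lemma_of_metric hK
    (c := fun y => Metric.ball y (r y)) (fun _ => Metric.isOpen_ball)
    (fun y _ => Set.mem_iUnion.2 ⟨y, Metric.mem_ball_self (hr y)⟩)
  refine ⟨δ / 2, by positivity, fun x => ENNReal.toReal_le_of_le_ofReal hε.le ?_⟩
  by_cases h : ∃ z ∈ K, z ∈ Metric.ball x (δ / 2)
  · obtain ⟨z, hzK, hz⟩ := h
    obtain ⟨y, hy⟩ := hδK z hzK
    refine (measure_mono (fun w hw => hy ?_)).trans (hrμ y)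
    rw [Metric.mem_ball] at hw hz ⊢
    linarith [dist_triangle_right w z x]
  · push Not at h
    exact (measure_mono fun w hw hwK => h w hwK hw).trans (hKμ μ rfl)

section Pointwise

variable {H : Type*} [NormedAddCommGroup H] [InnerProductSpace ℝ H]

/-- The smoothed direction function `(z - x) / √(‖z - x‖² + δ²)`. -/
noncomputable def smoothDir (δ : ℝ) (x z : H) : H := (√(‖z - x‖ ^ 2 + δ ^ 2))⁻¹ • (z - x)

theorem norm_gdir_le_one (x z : H) : ‖gdir x z‖ ≤ 1 := by
  rw [gdir, norm_smul, norm_inv, norm_norm]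
  exact inv_mul_le_one

theorem norm_smul_gdir (x z : H) : ‖z - x‖ • gdir x z = z - x := by
  by_cases h : z - x = 0
  · simp [h]
  · rw [gdir, smul_inv_smul₀ (norm_ne_zero_iff.2 h)]

theorem inner_gdir_sub (x z : H) : inner ℝ (gdir x z) (z - x) = ‖z - x‖ := by
  rw [gdir, real_inner_smul_left, real_inner_self_eq_norm_sq]
  by_cases h : ‖z - x‖ = 0
  · simp [h]
  · field_simp

theorem norm_smoothDir {δ : ℝ} (x z : H) :
    ‖smoothDir δ x z‖ = ‖z - x‖ / √(‖z - x‖ ^ 2 + δ ^ 2) := by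
  rw [smoothDir, norm_smul, norm_inv, Real.norm_of_nonneg (Real.sqrt_nonneg _), div_eq_inv_mul]

theorem le_sqrt_sq_add_sq (t δ : ℝ) : t ≤ √(t ^ 2 + δ ^ 2) :=
  Real.le_sqrt_of_sq_le (by nlinarith [sq_nonneg δ])

theorem le_sqrt_sq_add_sq' (t δ : ℝ) : δ ≤ √(t ^ 2 + δ ^ 2) :=
  Real.le_sqrt_of_sq_le (by nlinarith [sq_nonneg t])

theorem sqrt_sq_add_sq_le {t δ : ℝ} (ht : 0 ≤ t) (hδ : 0 ≤ δ) : √(t ^ 2 + δ ^ 2) ≤ t + δ :=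
  Real.sqrt_le_iff.2 ⟨by positivity, by nlinarith [mul_nonneg ht hδ]⟩

theorem abs_sqrt_sub_sqrt_le {δ : ℝ} (hδ : 0 < δ) {s t : ℝ} (hs : 0 ≤ s) (ht : 0 ≤ t) :
    |√(s ^ 2 + δ ^ 2) - √(t ^ 2 + δ ^ 2)| ≤ |s - t| := by
  have hS := le_sqrt_sq_add_sq s δ
  have hT := le_sqrt_sq_add_sq t δ
  have hS' := hδ.trans_le (le_sqrt_sq_add_sq' s δ)
  have hT' := hδ.trans_le (le_sqrt_sq_add_sq' t δ)
  have hS2 := Real.sq_sqrt (show 0 ≤ s ^ 2 + δ ^ 2 by positivity)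
  have hT2 := Real.sq_sqrt (show 0 ≤ t ^ 2 + δ ^ 2 by positivity)
  set S := √(s ^ 2 + δ ^ 2)
  set T := √(t ^ 2 + δ ^ 2)
  have h1 : (S - T) * (S + T) = (s - t) * (s + t) := by nlinarith
  have h2 : |S - T| * (S + T) = |s - t| * (s + t) := by
    rw [← abs_of_pos (add_pos hS' hT'), ← abs_mul, h1, abs_mul, abs_of_nonneg (add_nonneg hs ht)]
  have h3 : |s - t| * (s + t) ≤ |s - t| * (S + T) :=
    mul_le_mul_of_nonneg_left (by linarith) (abs_nonneg _)
  exact le_of_mul_le_mul_right (h2.trans_le h3) (add_pos hS' hT')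

theorem norm_smoothDir_le_one {δ : ℝ} (x z : H) : ‖smoothDir δ x z‖ ≤ 1 := by
  rw [norm_smoothDir]
  exact div_le_one_of_le₀ (le_sqrt_sq_add_sq _ _) (Real.sqrt_nonneg _)

theorem norm_smoothDir_sub_le {δ : ℝ} (hδ : 0 < δ) (x z w : H) :
    ‖smoothDir δ x z - smoothDir δ x w‖ ≤ 2 / δ * dist z w := by
  have hS' := le_sqrt_sq_add_sq' ‖z - x‖ δ
  have hT := le_sqrt_sq_add_sq ‖w - x‖ δ
  have hT' := le_sqrt_sq_add_sq' ‖w - x‖ δ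
  have hST := abs_sqrt_sub_sqrt_le hδ (norm_nonneg (w - x)) (norm_nonneg (z - x))
  have hn : |‖w - x‖ - ‖z - x‖| ≤ ‖z - w‖ := by
    simpa [norm_sub_rev] using abs_norm_sub_norm_le (w - x) (z - x)
  rw [smoothDir, smoothDir, dist_eq_norm]
  set S := √(‖z - x‖ ^ 2 + δ ^ 2)
  set T := √(‖w - x‖ ^ 2 + δ ^ 2)
  have hSp : 0 < S := hδ.trans_le hS'
  have hTp : 0 < T := hδ.trans_le hT'
  have h1 : S⁻¹ • (z - x) - T⁻¹ • (w - x) = S⁻¹ • (z - w) + (S⁻¹ - T⁻¹) • (w - x) := by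
    module
  have h2 : S⁻¹ - T⁻¹ = (T - S) / (S * T) := by field_simp
  have h3 : ‖S⁻¹ • (z - w)‖ ≤ δ⁻¹ * ‖z - w‖ := by
    rw [norm_smul, Real.norm_of_nonneg (by positivity)]
    gcongr
  have h4 : ‖(S⁻¹ - T⁻¹) • (w - x)‖ ≤ δ⁻¹ * ‖z - w‖ := by
    rw [norm_smul, h2, Real.norm_eq_abs, abs_div, abs_of_pos (mul_pos hSp hTp)]
    calc |T - S| / (S * T) * ‖w - x‖ ≤ ‖z - w‖ / (S * T) * T := by
          gcongr; exact hST.trans hn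
      _ = S⁻¹ * ‖z - w‖ := by field_simp
      _ ≤ _ := by gcongr
  calc _ ≤ δ⁻¹ * ‖z - w‖ + δ⁻¹ * ‖z - w‖ := by
        rw [h1]; exact (norm_add_le _ _).trans (add_le_add h3 h4)
    _ = _ := by ring

theorem norm_gdir_sub_smoothDir_le {δ : ℝ} (x z : H) :
    ‖gdir x z - smoothDir δ x z‖ ≤ 1 - ‖smoothDir δ x z‖ := by
  by_cases h : z - x = 0
  · simp [gdir, smoothDir, h]
  have ht : 0 < ‖z - x‖ := norm_pos_iff.2 h
  have hS := le_sqrt_sq_add_sq ‖z - x‖ δ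
  rw [norm_smoothDir, gdir, smoothDir, ← sub_smul, norm_smul]
  set S := √(‖z - x‖ ^ 2 + δ ^ 2)
  rw [Real.norm_of_nonneg (sub_nonneg.2 (inv_anti₀ ht hS))]
  apply le_of_eq
  field_simp

theorem one_sub_norm_smoothDir_le {δ η : ℝ} (hδ : 0 < δ) (hη : 0 < η) (x z : H) :
    1 - ‖smoothDir δ x z‖ ≤ (Metric.ball x η).indicator 1 z + δ / η := by
  by_cases hz : z ∈ Metric.ball x η
  · have : 0 < δ / η := by positivity
    simp only [Set.indicator_of_mem hz, Pi.one_apply]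
    linarith [norm_nonneg (smoothDir δ x z)]
  rw [Set.indicator_of_notMem hz, zero_add, norm_smoothDir]
  rw [Metric.mem_ball, dist_eq_norm, not_lt] at hz
  have hS := le_sqrt_sq_add_sq ‖z - x‖ δ
  have hS' := sqrt_sq_add_sq_le (norm_nonneg (z - x)) hδ.le
  set S := √(‖z - x‖ ^ 2 + δ ^ 2)
  have hSp : 0 < S := by linarith
  rw [one_sub_div hSp.ne']
  gcongr <;> linarith

/-- The descent inequality for the function `a ↦ √(‖a‖² + δ²)`. -/
theorem sqrt_norm_sub_sq_le {δ : ℝ} (hδ : 0 < δ) (x z h : H) :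
    √(‖z - (x + h)‖ ^ 2 + δ ^ 2) ≤
      √(‖z - x‖ ^ 2 + δ ^ 2) - inner ℝ (smoothDir δ x z) h + ‖h‖ ^ 2 / (2 * δ) := by
  have hS' := le_sqrt_sq_add_sq' ‖z - x‖ δ
  have hS2 := Real.sq_sqrt (show 0 ≤ ‖z - x‖ ^ 2 + δ ^ 2 by positivity)
  rw [smoothDir, real_inner_smul_left, show z - (x + h) = (z - x) - h by abel,
    norm_sub_sq_real]
  set S := √(‖z - x‖ ^ 2 + δ ^ 2)
  have hSp : 0 < S := hδ.trans_le hS'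
  set p := inner ℝ (z - x) h
  have hsq : ‖z - x‖ ^ 2 - 2 * p + ‖h‖ ^ 2 + δ ^ 2 = S ^ 2 - 2 * p + ‖h‖ ^ 2 := by
    rw [hS2]; ring
  have hnn : 0 ≤ S ^ 2 - 2 * p + ‖h‖ ^ 2 := by
    rw [hS2]
    nlinarith [norm_sub_sq_real (z - x) h, sq_nonneg ‖z - x - h‖, sq_nonneg δ]
  have h1 : √(S ^ 2 - 2 * p + ‖h‖ ^ 2) ≤ S - S⁻¹ * p + ‖h‖ ^ 2 / (2 * S) := by
    have e : S - S⁻¹ * p + ‖h‖ ^ 2 / (2 * S) = (S ^ 2 + (S ^ 2 - 2 * p + ‖h‖ ^ 2)) / (2 * S) := by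
      field_simp; ring
    rw [e, le_div_iff₀ (by positivity)]
    nlinarith [sq_nonneg (S - √(S ^ 2 - 2 * p + ‖h‖ ^ 2)), Real.sq_sqrt hnn]
  rw [hsq]
  refine h1.trans ?_
  gcongr

/-- The subgradient inequality for the norm between `x` and the origin. -/
theorem norm_sub_sub_norm_le_neg_inner_gdir (x z : H) :
    ‖z - x‖ - ‖z‖ ≤ - inner ℝ (gdir x z) x := by
  have h1 : inner ℝ (gdir x z) z ≤ ‖z‖ :=
    (real_inner_le_norm _ _).trans
      (mul_le_of_le_one_left (norm_nonneg _) (norm_gdir_le_one x z))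
  have h2 := inner_gdir_sub x z
  rw [inner_sub_right] at h2
  linarith

/-- A quantitative monotonicity property of the direction function. -/
theorem norm_sub_mul_norm_gdir_sub_sq_le (x y z : H) :
    ‖x - y‖ * ‖gdir y z - gdir x z‖ ^ 2 ≤ 2 * inner ℝ (gdir y z - gdir x z) (x - y) := by
  by_cases hx : z = x
  · subst hx
    have h0 : gdir z z = 0 := by simp [gdir]
    have h1 := norm_gdir_le_one y z
    rw [h0, sub_zero, inner_gdir_sub]
    nlinarith [mul_le_of_le_one_right (norm_nonneg (z - y))
      (pow_le_one₀ (n := 2) (norm_nonneg (gdir y z)) h1), norm_nonneg (z - y)]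
  by_cases hy : z = y
  · subst hy
    have h0 : gdir z z = 0 := by simp [gdir]
    rw [h0, zero_sub, norm_neg, inner_neg_left, ← inner_neg_right, neg_sub, norm_sub_rev x z, inner_gdir_sub]
    nlinarith [mul_le_of_le_one_right (norm_nonneg (z - x))
      (pow_le_one₀ (n := 2) (norm_nonneg (gdir x z)) (norm_gdir_le_one x z)),
      norm_nonneg (z - x)]
  have unit {w : H} (hw : z ≠ w) : ‖gdir w z‖ = 1 := by
    rw [gdir, norm_smul, norm_inv, norm_norm, inv_mul_cancel₀ (norm_ne_zero_iff.2 (sub_ne_zero.2 hw))]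
  have hp := unit hy
  have hq := unit hx
  have hle : ‖x - y‖ ≤ ‖z - y‖ + ‖z - x‖ := by
    simpa [norm_sub_rev] using norm_sub_le (z - y) (z - x)
  have e : x - y = ‖z - y‖ • gdir y z - ‖z - x‖ • gdir x z := by
    rw [norm_smul_gdir, norm_smul_gdir]; abel
  have e2 : 2 * inner ℝ (gdir y z - gdir x z) (x - y) =
      (‖z - y‖ + ‖z - x‖) * ‖gdir y z - gdir x z‖ ^ 2 := by
    rw [e, norm_sub_sq_real, inner_sub_left, inner_sub_right, inner_sub_right]
    simp only [real_inner_smul_right, real_inner_self_eq_norm_sq, hp, hq,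
      real_inner_comm (gdir y z) (gdir x z)]
    ring
  rw [e2]
  gcongr

theorem continuous_smoothDir {δ : ℝ} (hδ : 0 < δ) (x : H) : Continuous (smoothDir δ x) :=
  (LipschitzWith.of_dist_le_mul (K := ⟨2 / δ, by positivity⟩) fun z w => by
    rw [dist_eq_norm]; exact norm_smoothDir_sub_le hδ x z w).continuous

end Pointwise

theorem integrable_norm_sub_sub_norm {E : Type*} [NormedAddCommGroup E]
    [SecondCountableTopology E] [MeasurableSpace E] [BorelSpace E] (μ : Measure E)
    [IsFiniteMeasure μ] (x : E) :
    Integrable (fun z => ‖z - x‖ - ‖z‖) μ :=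
  Integrable.of_bound (by fun_prop) ‖x‖ (Eventually.of_forall fun z => by
    simpa using abs_norm_sub_norm_le (z - x) z)

/-- The objective function of the geometric median is coercive. -/
theorem exists_forall_half_norm_sub_le_integral {E : Type*} [NormedAddCommGroup E]
    [CompleteSpace E] [SecondCountableTopology E] [MeasurableSpace E] [BorelSpace E]
    (μ : Measure E) [IsProbabilityMeasure μ] :
    ∃ C, ∀ x : E, ‖x‖ / 2 - C ≤ ∫ z, (‖z - x‖ - ‖z‖) ∂μ := by
  obtain ⟨K, hK, hKμ⟩ := isTightMeasureSet_iff_exists_isCompact_measure_compl_le.1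
    (isTightMeasureSet_singleton (μ := μ)) (ENNReal.ofReal (1 / 4)) (by simp)
  have hKμ' : μ.real Kᶜ ≤ 1 / 4 := ENNReal.toReal_le_of_le_ofReal (by norm_num) (hKμ μ rfl)
  obtain ⟨R, hR, hKR⟩ := hK.isBounded.exists_pos_norm_le
  refine ⟨2 * R, fun x => ?_⟩
  have hi : Integrable (Kᶜ.indicator (fun _ => 2 * ‖x‖)) μ :=
    (integrable_const _).indicator hK.measurableSet.compl
  calc ‖x‖ / 2 - 2 * R ≤ (‖x‖ - 2 * R) - μ.real Kᶜ * (2 * ‖x‖) := by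
        nlinarith [norm_nonneg x]
    _ = ∫ z, ((‖x‖ - 2 * R) - Kᶜ.indicator (fun _ => 2 * ‖x‖) z) ∂μ := by
        rw [integral_sub (integrable_const _) hi,
          integral_indicator_const _ hK.measurableSet.compl]
        simp
    _ ≤ _ := by
        refine integral_mono ((integrable_const _).sub hi) (integrable_norm_sub_sub_norm μ x)
          fun z => ?_
        have h1 := norm_sub_norm_le z x
        have h2 := norm_sub_norm_le x z
        rw [norm_sub_rev] at h2
        by_cases hz : z ∈ K
        · have := hKR z hz
          simp only [Set.indicator_of_notMem (Set.notMem_compl_iff.2 hz)]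
          linarith
        · simp only [Set.indicator_of_mem (Set.mem_compl hz)]
          linarith

section Integral

variable {H : Type*} [NormedAddCommGroup H] [InnerProductSpace ℝ H]
  [SecondCountableTopology H] [MeasurableSpace H] [BorelSpace H]

theorem measurable_gdir (x : H) : Measurable (gdir x) := by
  unfold gdir
  fun_prop

theorem integrable_gdir (μ : Measure H) [IsFiniteMeasure μ] (x : H) : Integrable (gdir x) μ :=
  Integrable.of_bound (measurable_gdir x).aestronglyMeasurable 1
    (Eventually.of_forall (norm_gdir_le_one x))

theorem integrable_smoothDir (μ : Measure H) [IsFiniteMeasure μ] {δ : ℝ} (hδ : 0 < δ) (x : H) :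
    Integrable (smoothDir δ x) μ :=
  Integrable.of_bound (continuous_smoothDir hδ x).measurable.aestronglyMeasurable 1
    (Eventually.of_forall (norm_smoothDir_le_one x))

theorem integrable_one_sub_norm_smoothDir (μ : Measure H) [IsFiniteMeasure μ] {δ : ℝ}
    (hδ : 0 < δ) (x : H) : Integrable (fun z => 1 - ‖smoothDir δ x z‖) μ :=
  (integrable_const 1).sub (integrable_smoothDir μ hδ x).norm

theorem norm_integral_gdir_sub_integral_smoothDir_le (μ : Measure H) [IsFiniteMeasure μ] {δ : ℝ}
    (hδ : 0 < δ) (x : H) :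
    ‖∫ z, gdir x z ∂μ - ∫ z, smoothDir δ x z ∂μ‖ ≤ ∫ z, (1 - ‖smoothDir δ x z‖) ∂μ := by
  rw [← integral_sub (integrable_gdir μ x) (integrable_smoothDir μ hδ x)]
  exact norm_integral_le_of_norm_le (integrable_one_sub_norm_smoothDir μ hδ x)
    (Eventually.of_forall (norm_gdir_sub_smoothDir_le x))

theorem exists_forall_integral_one_sub_norm_smoothDir_le [CompleteSpace H] (μ : Measure H)
    [IsProbabilityMeasure μ] (hμ : ∀ x, μ {x} = 0) {ε : ℝ} (hε : 0 < ε) :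
    ∃ δ > 0, ∀ x, ∫ z, (1 - ‖smoothDir δ x z‖) ∂μ ≤ ε := by
  obtain ⟨η, hη, hball⟩ := exists_forall_measureReal_ball_le μ hμ (half_pos hε)
  have hδ : 0 < ε / 2 * η := by positivity
  refine ⟨ε / 2 * η, hδ, fun x => ?_⟩
  have hi : Integrable ((Metric.ball x η).indicator (1 : H → ℝ)) μ :=
    (integrable_const 1).indicator Metric.isOpen_ball.measurableSet
  calc ∫ z, (1 - ‖smoothDir (ε / 2 * η) x z‖) ∂μ
      ≤ ∫ z, ((Metric.ball x η).indicator 1 z + ε / 2 * η / η) ∂μ :=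
        integral_mono (integrable_one_sub_norm_smoothDir μ hδ x)
          (hi.add (integrable_const _)) (one_sub_norm_smoothDir_le hδ hη x)
    _ = μ.real (Metric.ball x η) + ε / 2 := by
        rw [integral_add hi (integrable_const _),
          integral_indicator_one Metric.isOpen_ball.measurableSet]
        simp [mul_div_cancel_right₀ _ hη.ne']
    _ ≤ ε := by linarith [hball x]

theorem eventually_forall_norm_integral_smoothDir_sub_le [CompleteSpace H]
    {Pn : ℕ → ProbabilityMeasure H} {P : ProbabilityMeasure H}
    (hweak : Tendsto Pn atTop (𝓝 P)) {δ : ℝ} (hδ : 0 < δ) {ε : ℝ} (hε : 0 < ε) :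
    ∀ᶠ n in atTop, ∀ x : H,
      ‖∫ z, smoothDir δ x z ∂(Pn n : Measure H) - ∫ z, smoothDir δ x z ∂(P : Measure H)‖ ≤ ε := by
  filter_upwards [eventually_forall_abs_integral_sub_le hweak
    (show 0 ≤ 2 / δ by positivity) hε] with n hn x
  set u := ∫ z, smoothDir δ x z ∂(Pn n : Measure H) - ∫ z, smoothDir δ x z ∂(P : Measure H)
    with hu
  have hv : ‖‖u‖⁻¹ • u‖ ≤ 1 := by
    rw [norm_smul, norm_inv, norm_norm]; exact inv_mul_le_one
  have h1 := hn (fun z => inner ℝ (‖u‖⁻¹ • u) (smoothDir δ x z))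
    (fun z w => by
      rw [← inner_sub_right]
      exact (abs_real_inner_le_norm _ _).trans ((mul_le_of_le_one_left (norm_nonneg _) hv).trans
        (norm_smoothDir_sub_le hδ x z w)))
    (fun z => (abs_real_inner_le_norm _ _).trans
      (mul_le_one₀ hv (norm_nonneg _) (norm_smoothDir_le_one x z)))
  rw [integral_inner (integrable_smoothDir _ hδ x), integral_inner (integrable_smoothDir _ hδ x),
    ← inner_sub_right, ← hu, real_inner_smul_left, real_inner_self_eq_norm_sq] at h1
  refine le_trans (le_of_eq ?_) ((le_abs_self _).trans h1)
  by_cases h : ‖u‖ = 0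
  · simp [h]
  · field_simp

/-- If `Pn → P` weakly and `P` has no atoms, then the mean directions converge uniformly. -/
theorem eventually_forall_norm_integral_gdir_sub_le [CompleteSpace H]
    {Pn : ℕ → ProbabilityMeasure H} {P : ProbabilityMeasure H}
    (hweak : Tendsto Pn atTop (𝓝 P)) (hP : ∀ x, (P : Measure H) {x} = 0) {ε : ℝ} (hε : 0 < ε) :
    ∀ᶠ n in atTop, ∀ x : H,
      ‖∫ z, gdir x z ∂(Pn n : Measure H) - ∫ z, gdir x z ∂(P : Measure H)‖ ≤ ε := by
  obtain ⟨δ, hδ, hδP⟩ :=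
    exists_forall_integral_one_sub_norm_smoothDir_le (P : Measure H) hP
      (show 0 < ε / 4 by positivity)
  filter_upwards [eventually_forall_norm_integral_smoothDir_sub_le hweak hδ
    (show 0 < ε / 4 by positivity), eventually_forall_abs_integral_sub_le hweak
    (show 0 ≤ 2 / δ by positivity) (show 0 < ε / 4 by positivity)] with n hn hn' x
  have h1 := (abs_le.1 (hn' (fun z => 1 - ‖smoothDir δ x z‖)
    (fun z w => by
      rw [sub_sub_sub_cancel_left, abs_sub_comm]
      exact (abs_norm_sub_norm_le _ _).trans (norm_smoothDir_sub_le hδ x z w))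
    (fun z => by
      rw [abs_le]
      constructor <;> linarith [norm_nonneg (smoothDir δ x z), norm_smoothDir_le_one (δ := δ) x z]))).2
  have h2 := norm_integral_gdir_sub_integral_smoothDir_le (Pn n : Measure H) hδ x
  have h3 := norm_integral_gdir_sub_integral_smoothDir_le (P : Measure H) hδ x
  rw [norm_sub_rev] at h3
  have h4 := norm_sub_le_norm_sub_add_norm_sub (∫ z, gdir x z ∂(Pn n : Measure H))
    (∫ z, smoothDir δ x z ∂(Pn n : Measure H)) (∫ z, gdir x z ∂(P : Measure H))
  have h5 := norm_sub_le_norm_sub_add_norm_sub (∫ z, smoothDir δ x z ∂(Pn n : Measure H))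
    (∫ z, smoothDir δ x z ∂(P : Measure H)) (∫ z, gdir x z ∂(P : Measure H))
  linarith [hn x, hδP x]

/-- For an atomless probability measure the mean direction can be made arbitrarily small. -/
theorem exists_norm_integral_gdir_le [CompleteSpace H] (μ : Measure H)
    [IsProbabilityMeasure μ] (hμ : ∀ x, μ {x} = 0) {ε : ℝ} (hε : 0 < ε) :
    ∃ x : H, ‖∫ z, gdir x z ∂μ‖ ≤ ε := by
  obtain ⟨δ, hδ, hδμ⟩ := exists_forall_integral_one_sub_norm_smoothDir_le μ hμ (half_pos hε)
  obtain ⟨C, hC⟩ := exists_forall_half_norm_sub_le_integral μ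
  have hint (x : H) : Integrable (fun z => √(‖z - x‖ ^ 2 + δ ^ 2) - ‖z‖) μ := by
    refine Integrable.of_bound (by fun_prop) (‖x‖ + δ) (Eventually.of_forall fun z => ?_)
    have h1 := abs_le.1 (abs_norm_sub_norm_le (z - x) z)
    simp only [sub_sub_cancel_left, norm_neg] at h1
    have h2 := le_sqrt_sq_add_sq ‖z - x‖ δ
    have h3 := sqrt_sq_add_sq_le (norm_nonneg (z - x)) hδ.le
    rw [Real.norm_eq_abs, abs_le]
    constructor <;> linarith
  set φ : H → ℝ := fun x => ∫ z, (√(‖z - x‖ ^ 2 + δ ^ 2) - ‖z‖) ∂μ with hφ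
  have hbdd : BddBelow (Set.range φ) := by
    refine ⟨-C, ?_⟩
    rintro _ ⟨x, rfl⟩
    have h1 : ∫ z, (‖z - x‖ - ‖z‖) ∂μ ≤ φ x :=
      integral_mono (integrable_norm_sub_sub_norm μ x) (hint x)
        fun z => sub_le_sub_right (le_sqrt_sq_add_sq _ _) _
    linarith [hC x, norm_nonneg x]
  have hdesc (x h : H) :
      φ (x + h) ≤ φ x - inner ℝ (∫ z, smoothDir δ x z ∂μ) h + ‖h‖ ^ 2 / (2 * δ) := by
    have hin : Integrable (fun z => inner ℝ h (smoothDir δ x z)) μ :=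
      (integrable_smoothDir μ hδ x).const_inner h
    rw [real_inner_comm, ← integral_inner (integrable_smoothDir μ hδ x), hφ]
    have e : ∫ z, ((√(‖z - x‖ ^ 2 + δ ^ 2) - ‖z‖ - inner ℝ h (smoothDir δ x z)) +
        ‖h‖ ^ 2 / (2 * δ)) ∂μ = ∫ z, (√(‖z - x‖ ^ 2 + δ ^ 2) - ‖z‖) ∂μ
          - ∫ z, inner ℝ h (smoothDir δ x z) ∂μ + ‖h‖ ^ 2 / (2 * δ) := by
      rw [integral_add (by exact (hint x).sub hin) (integrable_const _),
        integral_sub (hint x) hin]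
      simp
    rw [← e]
    refine integral_mono (hint _) (((hint x).sub hin).add (integrable_const _)) fun z => ?_
    have := sqrt_norm_sub_sq_le hδ x z h
    rw [real_inner_comm] at this
    linarith
  obtain ⟨x, hx⟩ := exists_lt_of_ciInf_lt
    (show ⨅ x, φ x < (⨅ x, φ x) + δ * (ε / 2) ^ 2 / 2 by
      linarith [show 0 < δ * (ε / 2) ^ 2 / 2 by positivity])
  refine ⟨x, ?_⟩
  set v := ∫ z, smoothDir δ x z ∂μ
  have hv : ‖v‖ ≤ ε / 2 := by
    have h1 := (ciInf_le hbdd (x + δ • v)).trans (hdesc x (δ • v))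
    rw [real_inner_smul_right, real_inner_self_eq_norm_sq, norm_smul,
      Real.norm_of_nonneg hδ.le] at h1
    have e : (δ * ‖v‖) ^ 2 / (2 * δ) = δ * ‖v‖ ^ 2 / 2 := by field_simp
    rw [e] at h1
    have h2 : δ * ‖v‖ ^ 2 < δ * (ε / 2) ^ 2 := by linarith
    exact (lt_of_pow_lt_pow_left₀ 2 (by positivity) (lt_of_mul_lt_mul_left h2 hδ.le)).le
  have h3 := norm_integral_gdir_sub_integral_smoothDir_le μ hδ x
  have h4 := norm_le_norm_sub_add (∫ z, gdir x z ∂μ) v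
  linarith [hδμ x]

theorem tendsto_integral_gdir (μ : Measure H) [IsFiniteMeasure μ] (hμ : ∀ x, μ {x} = 0)
    {y : ℕ → H} {x : H} (hy : Tendsto y atTop (𝓝 x)) :
    Tendsto (fun n => ∫ z, gdir (y n) z ∂μ) atTop (𝓝 (∫ z, gdir x z ∂μ)) := by
  refine tendsto_integral_of_dominated_convergence (fun _ => 1)
    (fun n => (measurable_gdir _).aestronglyMeasurable) (integrable_const 1)
    (fun n => Eventually.of_forall (norm_gdir_le_one _)) ?_
  filter_upwards [compl_mem_ae_iff.2 (hμ x)] with z hz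
  have h : Tendsto (fun n => z - y n) atTop (𝓝 (z - x)) := hy.const_sub z
  exact (h.norm.inv₀ (norm_ne_zero_iff.2 (sub_ne_zero.2 hz))).smul h

theorem integral_norm_gdir_sub_sq_le [CompleteSpace H] (μ : Measure H) [IsFiniteMeasure μ]
    {x : H} (hx : ∫ z, gdir x z ∂μ = 0) (y : H) :
    ∫ z, ‖gdir x z - gdir y z‖ ^ 2 ∂μ ≤ 2 * ‖∫ z, gdir y z ∂μ‖ := by
  rcases eq_or_ne y x with rfl | hxy
  · simp
  have hpos : 0 < ‖y - x‖ := norm_pos_iff.2 (sub_ne_zero.2 hxy)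
  have hsub := (integrable_gdir μ x).sub (integrable_gdir μ y)
  have hi2 : Integrable (fun z => ‖gdir x z - gdir y z‖ ^ 2) μ := by
    refine Integrable.of_bound
      (((measurable_gdir x).sub (measurable_gdir y)).norm.pow_const 2).aestronglyMeasurable
      (2 ^ 2) (Eventually.of_forall fun z => ?_)
    rw [norm_pow, norm_norm]
    have := norm_sub_le (gdir x z) (gdir y z)
    gcongr
    linarith [norm_gdir_le_one x z, norm_gdir_le_one y z]
  have h1 : ∫ z, ‖y - x‖ * ‖gdir x z - gdir y z‖ ^ 2 ∂μ ≤
      ∫ z, 2 * inner ℝ (y - x) (gdir x z - gdir y z) ∂μ := by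
    refine integral_mono (hi2.const_mul _) ((hsub.const_inner _).const_mul 2) fun z => ?_
    have := norm_sub_mul_norm_gdir_sub_sq_le y x z
    rwa [real_inner_comm] at this
  have h2 : ∫ z, inner ℝ (y - x) (gdir x z - gdir y z) ∂μ ≤ ‖y - x‖ * ‖∫ z, gdir y z ∂μ‖ := by
    have := integral_inner (𝕜 := ℝ) hsub (y - x)
    simp only [Pi.sub_apply] at this
    rw [this, integral_sub (integrable_gdir μ x) (integrable_gdir μ y), hx, zero_sub,
      ← norm_neg (∫ z, gdir y z ∂μ)]
    exact real_inner_le_norm _ _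
  rw [integral_const_mul, integral_const_mul] at h1
  refine le_of_mul_le_mul_left (h1.trans ?_) hpos
  linarith

theorem exists_subseq_tendsto_gdir [CompleteSpace H] (μ : Measure H) [IsFiniteMeasure μ] {x : H}
    (hx : ∫ z, gdir x z ∂μ = 0) {y : ℕ → H}
    (hy : Tendsto (fun n => ‖∫ z, gdir (y n) z ∂μ‖) atTop (𝓝 0)) :
    ∃ ns : ℕ → ℕ, StrictMono ns ∧
      ∀ᵐ z ∂μ, Tendsto (fun k => gdir (y (ns k)) z) atTop (𝓝 (gdir x z)) := by
  have hmeas (n : ℕ) : AEStronglyMeasurable (gdir (y n)) μ :=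
    (measurable_gdir _).aestronglyMeasurable
  have hL2 : Tendsto (fun n => eLpNorm (gdir (y n) - gdir x) 2 μ) atTop (𝓝 0) := by
    have h1 : Tendsto (fun n => ∫ z, ‖gdir x z - gdir (y n) z‖ ^ 2 ∂μ) atTop (𝓝 0) :=
      squeeze_zero (fun n => integral_nonneg fun z => by positivity)
        (fun n => integral_norm_gdir_sub_sq_le μ hx (y n)) (by simpa using hy.const_mul 2)
    have h2 := ENNReal.tendsto_ofReal ((h1.sqrt))
    rw [Real.sqrt_zero, ENNReal.ofReal_zero] at h2
    refine h2.congr fun n => ?_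
    have hmem : MemLp (gdir (y n) - gdir x) 2 μ :=
      (MemLp.of_bound (hmeas n) 1 (Eventually.of_forall (norm_gdir_le_one _))).sub
        (MemLp.of_bound (measurable_gdir x).aestronglyMeasurable 1
          (Eventually.of_forall (norm_gdir_le_one _)))
    rw [hmem.eLpNorm_eq_integral_rpow_norm (by norm_num) (by norm_num), Real.sqrt_eq_rpow]
    simp [norm_sub_rev]
  exact (tendstoInMeasure_of_tendsto_eLpNorm (by norm_num) hmeas
    (measurable_gdir x).aestronglyMeasurable hL2).exists_seq_tendsto_ae

/-- If the mean direction vanishes only at `x`, then every sequence along which the mean direction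
tends to zero converges in norm to `x`. -/
theorem tendsto_of_tendsto_norm_integral_gdir [CompleteSpace H] (μ : Measure H)
    [IsProbabilityMeasure μ] (hμ : ∀ x, μ {x} = 0) {x : H} (hx : ∫ z, gdir x z ∂μ = 0)
    (huniq : ∀ w, ∫ z, gdir w z ∂μ = 0 → w = x) {y : ℕ → H}
    (hy : Tendsto (fun n => ‖∫ z, gdir (y n) z ∂μ‖) atTop (𝓝 0)) :
    Tendsto y atTop (𝓝 x) := by
  refine tendsto_of_subseq_tendsto fun ns hns => ?_
  have hy' := hy.comp hns
  obtain ⟨C, hC⟩ := exists_forall_half_norm_sub_le_integral μ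
  have hbound : ∀ᶠ n in atTop, ‖y (ns n)‖ ≤ 4 * C := by
    filter_upwards [hy'.eventually (Iio_mem_nhds (show (0 : ℝ) < 1 / 4 by norm_num))] with n hn
    have h1 : ∫ z, (‖z - y (ns n)‖ - ‖z‖) ∂μ ≤ ∫ z, inner ℝ (-y (ns n)) (gdir (y (ns n)) z) ∂μ := by
      refine integral_mono (integrable_norm_sub_sub_norm μ _)
        ((integrable_gdir μ _).const_inner _) fun z => ?_
      simp only [inner_neg_left]
      rw [real_inner_comm]
      exact norm_sub_sub_norm_le_neg_inner_gdir _ z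
    rw [integral_inner (integrable_gdir μ _)] at h1
    have h2 := real_inner_le_norm (-y (ns n)) (∫ z, gdir (y (ns n)) z ∂μ)
    rw [norm_neg] at h2
    simp only [Function.comp_apply] at hn
    have h3 := mul_le_mul_of_nonneg_left hn.le (norm_nonneg (y (ns n)))
    linarith [hC (y (ns n))]
  obtain ⟨ms, hms, hae⟩ := exists_subseq_tendsto_gdir μ hx hy'
  obtain ⟨z, hz⟩ := hae.exists
  obtain ⟨t, -, ks, hks, ht⟩ := tendsto_subseq_of_frequently_bounded
    (Metric.isBounded_closedBall (x := (0 : ℝ)) (r := ‖z‖ + 4 * C))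
    (x := fun k => ‖z - y (ns (ms k))‖)
    ((hms.tendsto_atTop.eventually hbound).mono fun k hk => by
      rw [mem_closedBall_zero_iff, norm_norm]
      exact (norm_sub_le _ _).trans (by linarith)).frequently
  have hlim : Tendsto (fun k => y (ns (ms (ks k)))) atTop (𝓝 (z - t • gdir x z)) := by
    refine ((ht.smul (hz.comp hks.tendsto_atTop)).const_sub z).congr fun k => ?_
    simp only [Function.comp_apply, norm_smul_gdir, sub_sub_cancel]
  refine ⟨ms ∘ ks, ?_⟩
  have h0 : ∫ w, gdir (z - t • gdir x z) w ∂μ = 0 :=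
    norm_eq_zero.1 (tendsto_nhds_unique (tendsto_integral_gdir μ hμ hlim).norm
      (hy'.comp (hms.tendsto_atTop.comp hks.tendsto_atTop)))
  rw [← huniq _ h0]
  exact hlim

end Integral

theorem stmt0 {H : Type*} [NormedAddCommGroup H] [InnerProductSpace ℝ H]
    [CompleteSpace H] [SecondCountableTopology H] [MeasurableSpace H] [BorelSpace H]
    (Pn : ℕ → ProbabilityMeasure H) (P : ProbabilityMeasure H)
    (hweak : Tendsto Pn atTop (𝓝 P))
    (hH1 : ∀ (y : H) (r : ℝ), 0 < r → (P : Measure H) {z | ‖z - y‖ = r} = 0)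
    (xstar : H)
    (hmin : ∀ x : H, x ≠ xstar →
      ‖∫ z, gdir xstar z ∂(P : Measure H)‖ < ‖∫ z, gdir x z ∂(P : Measure H)‖)
    (xn : ℕ → H)
    (hmax : ∀ n, ∀ x : H, depth x (Pn n : Measure H) ≤ depth (xn n) (Pn n : Measure H)) :
    Tendsto xn atTop (𝓝 xstar) := by
  rcases subsingleton_or_nontrivial H with hH | hH
  · simp [Subsingleton.elim xn fun _ => xstar]
  have hatom (x : H) : (P : Measure H) {x} = 0 := by
    obtain ⟨v, hv⟩ := exists_ne (0 : H)
    refine measure_mono_null ?_ (hH1 (x + v) ‖v‖ (norm_pos_iff.2 hv))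
    rintro _ rfl
    simp
  have hzero : ∫ z, gdir xstar z ∂(P : Measure H) = 0 := by
    refine norm_le_zero_iff.1 (le_of_forall_gt_imp_ge_of_dense fun ε hε => ?_)
    obtain ⟨x, hx⟩ := exists_norm_integral_gdir_le (P : Measure H) hatom hε
    rcases eq_or_ne x xstar with rfl | hne
    · exact hx
    · exact (hmin x hne).le.trans hx
  refine tendsto_of_tendsto_norm_integral_gdir (P : Measure H) hatom hzero (fun w hw => ?_) ?_
  · by_contra hne
    have := hmin w hne
    rw [hw, hzero] at this
    exact lt_irrefl _ this
  rw [Metric.tendsto_nhds]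
  intro ε hε
  filter_upwards [eventually_forall_norm_integral_gdir_sub_le hweak hatom
    (show 0 < ε / 3 by positivity)] with n hn
  have h1 := hn xstar
  rw [hzero, sub_zero] at h1
  have h2 := hmax n xstar
  rw [depth, depth] at h2
  have h3 := hn (xn n)
  rw [norm_sub_rev] at h3
  have h4 := norm_le_norm_sub_add (∫ z, gdir (xn n) z ∂(P : Measure H))
    (∫ z, gdir (xn n) z ∂(Pn n : Measure H))
  rw [dist_zero_right, norm_norm]
  linarith
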